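/- For any δ > 0, any Borel probability measure P on ℝ^d being the law of a random vector X, any z, b ∈ ℝ^d, and any d×d real matrix A with A Aᵀ = I (i.e., A orthogonal), the distributionally robust halfspace depth satisfies D_δ(Az + b | law of AX + b) = D_δ(z | law of X). -/

import Mathlib

open MeasureTheory RealInnerProductSpace
open scoped ENNReal

abbrev Ed (d : ℕ) := EuclideanSpace ℝ (Fin d)

/-- 1-Wasserstein distance between Borel measures on `ℝ^d`. -/
noncomputable def wassersteinDist {d : ℕ} (P Q : Measure (Ed d)) : ℝ≥0∞ :=
  ⨅ (π : Measure (Ed d × Ed d)) (_ : π.map Prod.fst = P) (_ : π.map Prod.snd = Q),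
    ∫⁻ p, ENNReal.ofReal ‖p.1 - p.2‖ ∂π

/-- Worst-case probability of a set over the Wasserstein ball of radius `δ` around `P`. -/
noncomputable def supProb {d : ℕ} (δ : ℝ) (P : Measure (Ed d)) (A : Set (Ed d)) : ℝ :=
  sSup {v : ℝ | ∃ Q : Measure (Ed d), IsProbabilityMeasure Q ∧
    wassersteinDist Q P ≤ ENNReal.ofReal δ ∧ v = (Q A).toReal}

/-- Distributionally robust halfspace depth. -/
noncomputable def robustDepth {d : ℕ} (δ : ℝ) (z : Ed d) (P : Measure (Ed d)) : ℝ :=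
  sInf {v : ℝ | ∃ u : Ed d, ‖u‖ = 1 ∧ v = supProb δ P {x | 0 ≤ ⟪u, x - z⟫}}

/-- Pushing both measures forward along an isometry does not increase the Wasserstein distance. -/
theorem wassersteinDist_map_le {d : ℕ} {e : Ed d → Ed d} (he : Isometry e)
    (P Q : Measure (Ed d)) :
    wassersteinDist (P.map e) (Q.map e) ≤ wassersteinDist P Q := by
  have hm : Measurable e := he.continuous.measurable
  refine le_iInf fun π => le_iInf fun h₁ => le_iInf fun h₂ => ?_
  have hmm : Measurable (Prod.map e e) := hm.prodMap hm
  refine iInf_le_of_le (π.map (Prod.map e e)) (iInf_le_of_le ?_ (iInf_le_of_le ?_ ?_))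
  · rw [Measure.map_map measurable_fst hmm, ← h₁, Measure.map_map hm measurable_fst]
    rfl
  · rw [Measure.map_map measurable_snd hmm, ← h₂, Measure.map_map hm measurable_snd]
    rfl
  · rw [lintegral_map (by fun_prop) hmm]
    simp [← dist_eq_norm, he.dist_eq]

theorem supProb_map {d : ℕ} (δ : ℝ) (e : Ed d ≃ᵢ Ed d) (P : Measure (Ed d)) (B : Set (Ed d)) :
    supProb δ (P.map e) B = supProb δ P (e ⁻¹' B) := by
  have hm : Measurable e := e.continuous.measurable
  have hm' : Measurable e.symm := e.symm.continuous.measurable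
  have map_symm_map (R : Measure (Ed d)) : (R.map e).map e.symm = R := by
    rw [Measure.map_map hm' hm, e.symm_comp_self, Measure.map_id]
  unfold supProb
  congr 1
  ext v
  constructor
  · rintro ⟨Q, hQ, hW, rfl⟩
    refine ⟨Q.map e.symm, Measure.isProbabilityMeasure_map hm'.aemeasurable, ?_, ?_⟩
    · have h := wassersteinDist_map_le e.symm.isometry Q (P.map e)
      rw [map_symm_map] at h
      exact h.trans hW
    · have h := e.symm.toHomeomorph.toMeasurableEquiv.map_apply (μ := Q) (e ⁻¹' B)
      simp only [Homeomorph.toMeasurableEquiv_coe, IsometryEquiv.coe_toHomeomorph,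
        ← Set.preimage_comp, IsometryEquiv.self_comp_symm, Set.preimage_id] at h
      rw [h]
  · rintro ⟨Q, hQ, hW, rfl⟩
    refine ⟨Q.map e, Measure.isProbabilityMeasure_map hm.aemeasurable,
      (wassersteinDist_map_le e.isometry Q P).trans hW, ?_⟩
    have h := e.toHomeomorph.toMeasurableEquiv.map_apply (μ := Q) B
    simp only [Homeomorph.toMeasurableEquiv_coe, IsometryEquiv.coe_toHomeomorph] at h
    rw [h]

theorem robustDepth_map_linearIsometryEquiv_add {d : ℕ} (δ : ℝ) (L : Ed d ≃ₗᵢ[ℝ] Ed d)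
    (P : Measure (Ed d)) (z b : Ed d) :
    robustDepth δ (L z + b) (P.map (fun x => L x + b)) = robustDepth δ z P := by
  have supProb_halfspace (u : Ed d) :
      supProb δ (P.map (fun x => L x + b)) {x | 0 ≤ ⟪L u, x - (L z + b)⟫} =
        supProb δ P {x | 0 ≤ ⟪u, x - z⟫} := by
    rw [show (fun x => L x + b) = L.toIsometryEquiv.trans (IsometryEquiv.addRight b) from rfl,
      supProb_map]
    congr 1
    ext x
    simp [← map_sub]
  unfold robustDepth
  congr 1
  ext v
  constructor
  · rintro ⟨u, hu, rfl⟩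
    refine ⟨L.symm u, by simpa using hu, ?_⟩
    rw [← supProb_halfspace, L.apply_symm_apply]
  · rintro ⟨u, hu, rfl⟩
    exact ⟨L u, by simpa using hu, (supProb_halfspace u).symm⟩

/-- **Isometric invariance (P1).** For any orthogonal matrix `A` and any `b`,
`D_δ(A z + b | law of A X + b) = D_δ(z | law of X)`. -/
theorem robustDepth_isometry_invariant {d : ℕ} (δ : ℝ) (hδ : 0 < δ)
    (P : Measure (Ed d)) [IsProbabilityMeasure P] (z b : Ed d)
    (A : Matrix (Fin d) (Fin d) ℝ) (hA : A * A.transpose = 1) :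
    robustDepth δ (Matrix.toEuclideanLin A z + b)
      (P.map (fun x => Matrix.toEuclideanLin A x + b)) = robustDepth δ z P := by
  have hAt : A.transpose * A = 1 := mul_eq_one_comm.mp hA
  have inner_map (x y : Ed d) :
      ⟪Matrix.toEuclideanLin A x, Matrix.toEuclideanLin A y⟫ = ⟪x, y⟫ := by
    rw [← LinearMap.adjoint_inner_right, ← Matrix.toEuclideanLin_conjTranspose_eq_adjoint,
      Matrix.conjTranspose_eq_transpose_of_trivial]
    simp [Matrix.toLpLin_apply, hAt]
  let L := ((Matrix.toEuclideanLin A).isometryOfInner inner_map).toLinearIsometryEquiv rfl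
  exact robustDepth_map_linearIsometryEquiv_add δ L P z b
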